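/- arXiv:1310.4453 — 7 statements merged into one kernel-verified Lean document; each statement's English description precedes it below -/
import Mathlib

section
/- Let I ⊆ ℝ be an interval and let F : I ⇒ ℝ be a set-valued function with F(x) ≠ ∅ for all x ∈ I. If F is locally strictly quasimonotone on I (i.e., every x ∈ I admits an open neighborhood U ⊆ ℝ such that the restriction of F to U ∩ I is strictly quasimonotone), then F is strictly quasimonotone on I. -/
open Set Filter

/-- Quasimonotone set-valued function on a set `S ⊆ ℝ`. -/
def SVQuasimonotoneOn (F : ℝ → Set ℝ) (S : Set ℝ) : Prop :=
  ∀ x ∈ S, ∀ y ∈ S, ∀ xs ∈ F x, ∀ ys ∈ F y, xs * (y - x) > 0 → ys * (y - x) ≥ 0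

/-- Strictly quasimonotone set-valued function on a set `S ⊆ ℝ`. -/
def SVStrictlyQuasimonotoneOn (F : ℝ → Set ℝ) (S : Set ℝ) : Prop :=
  SVQuasimonotoneOn F S ∧
    ∀ x ∈ S, ∀ y ∈ S, x ≠ y →
      ∃ z ∈ openSegment ℝ x y, z ∈ S ∧ ∃ zs ∈ F z, zs * (y - x) ≠ 0

/-- Pseudomonotone set-valued function on a set `S ⊆ ℝ`. -/
def SVPseudomonotoneOn (F : ℝ → Set ℝ) (S : Set ℝ) : Prop :=
  ∀ x ∈ S, ∀ y ∈ S, ∀ xs ∈ F x, ∀ ys ∈ F y, xs * (y - x) ≥ 0 → ys * (y - x) ≥ 0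

/-- Strictly pseudomonotone set-valued function on a set `S ⊆ ℝ`. -/
def SVStrictlyPseudomonotoneOn (F : ℝ → Set ℝ) (S : Set ℝ) : Prop :=
  ∀ x ∈ S, ∀ y ∈ S, x ≠ y → ∀ xs ∈ F x, ∀ ys ∈ F y, xs * (y - x) ≥ 0 → ys * (y - x) > 0

/-- Monotone set-valued function on a set `S ⊆ ℝ`. -/
def SVMonotoneOn (F : ℝ → Set ℝ) (S : Set ℝ) : Prop :=
  ∀ x ∈ S, ∀ y ∈ S, ∀ xs ∈ F x, ∀ ys ∈ F y, (xs - ys) * (x - y) ≥ 0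

/-- Lower semicontinuity of a set-valued function on `I`. -/
def SVLscOn (F : ℝ → Set ℝ) (I : Set ℝ) : Prop :=
  ∀ x ∈ I, ∀ N : Set ℝ, IsOpen N → (F x ∩ N).Nonempty →
    ∃ M ∈ nhds x, ∀ y ∈ M ∩ I, (F y ∩ N).Nonempty

theorem svQuasimonotoneOn_iff_forall_lt {F : ℝ → Set ℝ} {S : Set ℝ} :
    SVQuasimonotoneOn F S ↔
      ∀ x ∈ S, ∀ y ∈ S, x < y → ∀ xs ∈ F x, ∀ ys ∈ F y, 0 < xs → 0 ≤ ys := by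
  constructor
  · intro h x hx y hy hxy xs hxs ys hys hpos
    exact nonneg_of_mul_nonneg_left (h x hx y hy xs hxs ys hys (mul_pos hpos (sub_pos.2 hxy)))
      (sub_pos.2 hxy)
  · intro h x hx y hy xs hxs ys hys hpos
    rcases lt_trichotomy x y with hxy | rfl | hyx
    · exact mul_nonneg (h x hx y hy hxy xs hxs ys hys
        (pos_of_mul_pos_left hpos (sub_pos.2 hxy).le)) (sub_pos.2 hxy).le
    · simp
    · by_contra! hneg
      have hxs_neg : xs < 0 := by nlinarith
      have hys_pos : 0 < ys := by nlinarith
      exact hxs_neg.not_ge (h y hy x hx hyx ys hys xs hxs hys_pos)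

/-- Near any point, local strict quasimonotonicity passes to the trace of a metric ball. -/
theorem exists_ball_of_locally_strictly_quasimonotone {I : Set ℝ} {F : ℝ → Set ℝ}
    (hloc : ∀ x ∈ I, ∃ U : Set ℝ, IsOpen U ∧ x ∈ U ∧ SVStrictlyQuasimonotoneOn F (U ∩ I))
    {s : ℝ} (hs : s ∈ I) :
    ∃ e > 0, (∀ p ∈ I, ∀ q ∈ I, s - e < p → p < q → q < s + e →
        ∀ ps ∈ F p, ∀ qs ∈ F q, 0 < ps → 0 ≤ qs) ∧
      ∀ p ∈ I, ∀ q ∈ I, s - e < p → p < q → q < s + e →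
        ∃ z ∈ Ioo p q, ∃ zs ∈ F z, zs ≠ 0 := by
  obtain ⟨U, hU, hsU, hqm, hdense⟩ := hloc s hs
  obtain ⟨e, he, hball⟩ := Metric.isOpen_iff.1 hU s hsU
  rw [Real.ball_eq_Ioo] at hball
  refine ⟨e, he, fun p hp q hq hsp hpq hqs => ?_, fun p hp q hq hsp hpq hqs => ?_⟩
  · exact svQuasimonotoneOn_iff_forall_lt.1 hqm p ⟨hball ⟨hsp, hpq.trans hqs⟩, hp⟩
      q ⟨hball ⟨hsp.trans hpq, hqs⟩, hq⟩ hpq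
  · obtain ⟨z, hz, -, zs, hzs, hne⟩ := hdense p ⟨hball ⟨hsp, hpq.trans hqs⟩, hp⟩
      q ⟨hball ⟨hsp.trans hpq, hqs⟩, hq⟩ hpq.ne
    rw [openSegment_eq_Ioo hpq] at hz
    exact ⟨z, hz, zs, hzs, left_ne_zero_of_mul hne⟩

theorem exists_ne_zero_of_locally_strictly_quasimonotone {I : Set ℝ} (hI : I.OrdConnected)
    {F : ℝ → Set ℝ}
    (hloc : ∀ x ∈ I, ∃ U : Set ℝ, IsOpen U ∧ x ∈ U ∧ SVStrictlyQuasimonotoneOn F (U ∩ I))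
    {x y : ℝ} (hx : x ∈ I) (hy : y ∈ I) (hxy : x < y) :
    ∃ z ∈ Ioo x y, ∃ zs ∈ F z, zs ≠ 0 := by
  obtain ⟨e, he, -, hdense⟩ := exists_ball_of_locally_strictly_quasimonotone hloc hx
  obtain ⟨w, hxw, hw⟩ := exists_between (lt_min hxy (lt_add_of_pos_right x he))
  obtain ⟨hwy, hwe⟩ := lt_min_iff.1 hw
  obtain ⟨z, hz, hzs⟩ := hdense x hx w (hI.out hx hy ⟨hxw.le, hwy.le⟩) (by linarith) hxw hwe
  exact ⟨z, ⟨hz.1, hz.2.trans hwy⟩, hzs⟩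

theorem quasimonotoneOn_of_locally_strictly_quasimonotone {I : Set ℝ} (hI : I.OrdConnected)
    {F : ℝ → Set ℝ}
    (hloc : ∀ x ∈ I, ∃ U : Set ℝ, IsOpen U ∧ x ∈ U ∧ SVStrictlyQuasimonotoneOn F (U ∩ I)) :
    SVQuasimonotoneOn F I := by
  rw [svQuasimonotoneOn_iff_forall_lt]
  intro a ha b hb hab as has bs hbs has_pos
  by_contra! hbs_neg
  let A : Set ℝ := {x | x ∈ Ico a b ∧ ∃ xs ∈ F x, 0 < xs}
  have haA : a ∈ A := ⟨⟨le_rfl, hab⟩, as, has, has_pos⟩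
  have hAb : BddAbove A := ⟨b, fun x hx => hx.1.2.le⟩
  have has' : a ≤ sSup A := le_csSup hAb haA
  have hsb : sSup A ≤ b := csSup_le ⟨a, haA⟩ fun x hx => hx.1.2.le
  have hsI : sSup A ∈ I := hI.out ha hb ⟨has', hsb⟩
  obtain ⟨e, he, hqm, -⟩ := exists_ball_of_locally_strictly_quasimonotone hloc hsI
  obtain ⟨p, hpA, hp⟩ := exists_lt_of_lt_csSup ⟨a, haA⟩ (sub_lt_self (sSup A) he)
  have hps : p ≤ sSup A := le_csSup hAb hpA
  obtain ⟨⟨hap, hpb⟩, ps, hpsF, hps_pos⟩ := hpA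
  have hpI : p ∈ I := hI.out ha hb ⟨hap, hpb.le⟩
  rcases hsb.lt_or_eq with hlt | heq
  · obtain ⟨w, hsw, hw⟩ := exists_between (lt_min hlt (lt_add_of_pos_right (sSup A) he))
    obtain ⟨hwb, hwe⟩ := lt_min_iff.1 hw
    obtain ⟨z, ⟨hsz, hzw⟩, zs, hzs, hzs_ne⟩ :=
      exists_ne_zero_of_locally_strictly_quasimonotone hI hloc hsI
        (hI.out ha hb ⟨has'.trans hsw.le, hwb.le⟩) hsw
    have hzb : z < b := hzw.trans hwb
    have haz : a ≤ z := has'.trans hsz.le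
    have hzs_nonneg : 0 ≤ zs := hqm p hpI z (hI.out ha hb ⟨haz, hzb.le⟩) hp (hps.trans_lt hsz)
      (hzw.trans hwe) ps hpsF zs hzs hps_pos
    exact hsz.not_ge
      (le_csSup hAb ⟨⟨haz, hzb⟩, zs, hzs, hzs_nonneg.lt_of_ne hzs_ne.symm⟩)
  · exact hbs_neg.not_ge (hqm p hpI b hb hp hpb (by linarith) ps hpsF bs hbs hps_pos)

/-- If a nonempty-valued set-valued function on an interval `I ⊆ ℝ` is locally strictly
quasimonotone on `I`, then it is strictly quasimonotone on `I`. -/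
theorem locally_strictly_quasimonotone_of_interval
    (I : Set ℝ) (hI : I.OrdConnected) (F : ℝ → Set ℝ)
    (hne : ∀ x ∈ I, (F x).Nonempty)
    (hloc : ∀ x ∈ I, ∃ U : Set ℝ, IsOpen U ∧ x ∈ U ∧ SVStrictlyQuasimonotoneOn F (U ∩ I)) :
    SVStrictlyQuasimonotoneOn F I := by
  refine ⟨quasimonotoneOn_of_locally_strictly_quasimonotone hI hloc, fun x hx y hy hxy => ?_⟩
  rcases hxy.lt_or_gt with h | h
  · obtain ⟨z, hz, zs, hzs, hzs_ne⟩ :=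
      exists_ne_zero_of_locally_strictly_quasimonotone hI hloc hx hy h
    exact ⟨z, by rwa [openSegment_eq_Ioo h], hI.out hx hy (Ioo_subset_Icc_self hz), zs, hzs,
      mul_ne_zero hzs_ne (sub_ne_zero.2 h.ne')⟩
  · obtain ⟨z, hz, zs, hzs, hzs_ne⟩ :=
      exists_ne_zero_of_locally_strictly_quasimonotone hI hloc hy hx h
    exact ⟨z, by rwa [openSegment_symm, openSegment_eq_Ioo h],
      hI.out hy hx (Ioo_subset_Icc_self hz), zs, hzs, mul_ne_zero hzs_ne (sub_ne_zero.2 h.ne)⟩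
end

section
/- Let I ⊆ ℝ be an interval and let F : I ⇒ ℝ be a set-valued function with F(x) ≠ ∅ for all x ∈ I. If F is locally pseudomonotone on I (i.e., every x ∈ I admits an open neighborhood U ⊆ ℝ such that the restriction of F to U ∩ I is pseudomonotone), then F is pseudomonotone on I. -/
open Set Filter

theorem SVPseudomonotoneOn.mono {F : ℝ → Set ℝ} {S T : Set ℝ}
    (h : SVPseudomonotoneOn F T) (hST : S ⊆ T) : SVPseudomonotoneOn F S :=
  fun x hx y hy ↦ h x (hST hx) y (hST hy)

/-- A value at an intermediate point transfers the sign condition from `a` to `b`. -/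
theorem SVPseudomonotoneOn.mul_sub_nonneg_of_between {F : ℝ → Set ℝ} {S T : Set ℝ} {a y b : ℝ}
    (hS : SVPseudomonotoneOn F S) (hT : SVPseudomonotoneOn F T)
    (ha : a ∈ S) (hyS : y ∈ S) (hyT : y ∈ T) (hb : b ∈ T) (hy : (F y).Nonempty)
    (hayb : a ≤ y ∧ y ≤ b ∨ b ≤ y ∧ y ≤ a) {u v : ℝ} (hu : u ∈ F a) (hv : v ∈ F b)
    (huab : u * (b - a) ≥ 0) : v * (b - a) ≥ 0 := by
  obtain ⟨w, hw⟩ := hy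
  have hay := hS a ha y hyS u hu w hw
  have hyb := hT y hyT b hb w hw v hv
  rcases eq_or_ne a y with rfl | hne₁
  · exact hT a hyT b hb u hu v hv huab
  rcases eq_or_ne y b with rfl | hne₂
  · exact hS a ha y hyS u hu v hv huab
  rcases hayb with ⟨h₁, h₂⟩ | ⟨h₁, h₂⟩
  · have h₁ := sub_pos.2 (lt_of_le_of_ne h₁ hne₁)
    have h₂ := sub_pos.2 (lt_of_le_of_ne h₂ hne₂)
    have hab : 0 < b - a := by linarith
    simp only [ge_iff_le, mul_nonneg_iff_of_pos_right, h₁, h₂, hab] at *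
    exact hyb (hay huab)
  · have h₁ := sub_neg.2 (lt_of_le_of_ne h₁ hne₂.symm)
    have h₂ := sub_neg.2 (lt_of_le_of_ne h₂ hne₁.symm)
    have hab : b - a < 0 := by linarith
    have key : ∀ {c d : ℝ}, d < 0 → (0 ≤ c * d ↔ c ≤ 0) := fun {c d} hd ↦
      ⟨fun h ↦ by by_contra! hc; exact absurd h (mul_neg_of_pos_of_neg hc hd).not_ge,
        fun h ↦ mul_nonneg_of_nonpos_of_nonpos h hd.le⟩
    simp only [ge_iff_le, key h₁, key h₂, key hab] at *
    exact hyb (hay huab)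

theorem SVPseudomonotoneOn.uIcc_trans {F : ℝ → Set ℝ} {x y z : ℝ} (hy : (F y).Nonempty)
    (hxy : SVPseudomonotoneOn F (uIcc x y)) (hyz : SVPseudomonotoneOn F (uIcc y z)) :
    SVPseudomonotoneOn F (uIcc x z) := by
  intro a ha b hb u hu v hv huv
  by_cases h₁ : a ∈ uIcc x y ∧ b ∈ uIcc x y
  · exact hxy a h₁.1 b h₁.2 u hu v hv huv
  by_cases h₂ : a ∈ uIcc y z ∧ b ∈ uIcc y z
  · exact hyz a h₂.1 b h₂.2 u hu v hv huv
  have ha' := uIcc_subset_uIcc_union_uIcc (b := y) ha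
  have hb' := uIcc_subset_uIcc_union_uIcc (b := y) hb
  have hayb : a ≤ y ∧ y ≤ b ∨ b ≤ y ∧ y ≤ a := by
    simp only [mem_uIcc, mem_union] at *
    grind
  rcases ha' with ha' | ha' <;> rcases hb' with hb' | hb'
  · exact absurd ⟨ha', hb'⟩ h₁
  · exact hxy.mul_sub_nonneg_of_between hyz ha' right_mem_uIcc left_mem_uIcc hb' hy hayb hu hv huv
  · exact hyz.mul_sub_nonneg_of_between hxy ha' left_mem_uIcc right_mem_uIcc hb' hy hayb hu hv huv
  · exact absurd ⟨ha', hb'⟩ h₂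

/-- If a nonempty-valued set-valued function on an interval `I ⊆ ℝ` is locally pseudomonotone
on `I`, then it is pseudomonotone on `I`. -/
theorem locally_pseudomonotone_of_interval
    (I : Set ℝ) (hI : I.OrdConnected) (F : ℝ → Set ℝ)
    (hne : ∀ x ∈ I, (F x).Nonempty)
    (hloc : ∀ x ∈ I, ∃ U : Set ℝ, IsOpen U ∧ x ∈ U ∧ SVPseudomonotoneOn F (U ∩ I)) :
    SVPseudomonotoneOn F I := by
  have key : ∀ x ∈ I, ∀ y ∈ I, SVPseudomonotoneOn F (uIcc x y) := by
    intro x hx y hy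
    refine hI.isPreconnected.induction₂ (fun x y ↦ SVPseudomonotoneOn F (uIcc x y)) ?_
      (fun x y z _ hy _ hxy hyz ↦ hxy.uIcc_trans (hne y hy) hyz)
      (fun x y _ _ h ↦ by simpa only [uIcc_comm] using h) hx hy
    intro x hx
    obtain ⟨U, hU, hxU, hF⟩ := hloc x hx
    obtain ⟨ε, hε, hball⟩ := Metric.isOpen_iff.1 hU x hxU
    filter_upwards [mem_nhdsWithin_of_mem_nhds (Metric.ball_mem_nhds x hε),
      self_mem_nhdsWithin] with y hyε hy
    have hconn : (Metric.ball x ε).OrdConnected := (convex_ball x ε).ordConnected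
    exact hF.mono (subset_inter
      ((hconn.uIcc_subset (Metric.mem_ball_self hε) hyε).trans hball) (hI.uIcc_subset hx hy))
  intro x hx y hy
  exact key x hx y hy x left_mem_uIcc y right_mem_uIcc
end

section
/- Let I ⊆ ℝ be an interval and let F : I ⇒ ℝ be a set-valued function with F(x) ≠ ∅ for all x ∈ I. If F is locally strictly pseudomonotone on I (i.e., every x ∈ I admits an open neighborhood U ⊆ ℝ such that the restriction of F to U ∩ I is strictly pseudomonotone), then F is strictly pseudomonotone on I. -/
open Set Filter

/-- Along an interval, a nonnegative value of a locally strictly pseudomonotone function forces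
all values further to the right to be positive. -/
theorem pos_of_nonneg_of_lt_of_locally_strictly_pseudomonotone
    {I : Set ℝ} (hI : I.OrdConnected) {F : ℝ → Set ℝ}
    (hne : ∀ x ∈ I, (F x).Nonempty)
    (hloc : ∀ x ∈ I, ∃ U : Set ℝ, IsOpen U ∧ x ∈ U ∧ SVStrictlyPseudomonotoneOn F (U ∩ I))
    {x y : ℝ} (hx : x ∈ I) (hy : y ∈ I) (hxy : x < y) {xs ys : ℝ} (hxs : xs ∈ F x)
    (hys : ys ∈ F y) (h : 0 ≤ xs) : 0 < ys := by
  choose! U hUo hUmem hU using hloc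
  have hsub : Icc x y ⊆ I := hI.out hx hy
  obtain ⟨t, ht0, htmono, ⟨m, hm⟩, ht⟩ :=
    exists_monotone_Icc_subset_open_cover_Icc hxy.le
      (c := fun i : Icc x y => Subtype.val ⁻¹' U i)
      (fun i => (hUo i (hsub i.2)).preimage continuous_subtype_val)
      (fun z _ => mem_iUnion.2 ⟨z, hUmem z (hsub z.2)⟩)
  have key : ∀ n, (t n : ℝ) = x ∨ ∀ v ∈ F (t n), 0 < v := by
    intro n
    induction n with
    | zero => exact .inl ht0
    | succ n ih =>
      have hle : t n ≤ t (n + 1) := htmono n.le_succ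
      rcases hle.eq_or_lt with heq | hlt
      · rwa [← heq]
      obtain ⟨i, hi⟩ := ht n
      have hlt' : (t n : ℝ) < t (n + 1) := hlt
      obtain ⟨w, hw, hw0⟩ : ∃ w ∈ F (t n), 0 ≤ w := by
        rcases ih with ih | ih
        · exact ⟨xs, by rwa [ih], h⟩
        · obtain ⟨w, hw⟩ := hne _ (hsub (t n).2)
          exact ⟨w, hw, (ih w hw).le⟩
      refine .inr fun v hv => ?_
      exact pos_of_mul_pos_left
        (hU i (hsub i.2) _ ⟨hi ⟨le_rfl, hle⟩, hsub (t n).2⟩ _ ⟨hi ⟨hle, le_rfl⟩, hsub (t (n + 1)).2⟩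
          hlt'.ne w hw v hv (mul_nonneg hw0 (sub_nonneg.2 hlt'.le)))
        (sub_nonneg.2 hlt'.le)
  have hm' := key m
  rw [hm m le_rfl] at hm'
  exact hm'.resolve_left hxy.ne' ys hys

/-- If a nonempty-valued set-valued function on an interval `I ⊆ ℝ` is locally strictly
pseudomonotone on `I`, then it is strictly pseudomonotone on `I`. -/
theorem locally_strictly_pseudomonotone_of_interval
    (I : Set ℝ) (hI : I.OrdConnected) (F : ℝ → Set ℝ)
    (hne : ∀ x ∈ I, (F x).Nonempty)
    (hloc : ∀ x ∈ I, ∃ U : Set ℝ, IsOpen U ∧ x ∈ U ∧ SVStrictlyPseudomonotoneOn F (U ∩ I)) :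
    SVStrictlyPseudomonotoneOn F I := by
  intro x hx y hy hxy xs hxs ys hys h
  rcases hxy.lt_or_gt with hlt | hlt
  · exact mul_pos
      (pos_of_nonneg_of_lt_of_locally_strictly_pseudomonotone hI hne hloc hx hy hlt hxs hys
        (nonneg_of_mul_nonneg_left h (sub_pos.2 hlt)))
      (sub_pos.2 hlt)
  · refine mul_pos_of_neg_of_neg ?_ (sub_neg.2 hlt)
    by_contra! hys0
    have :=
      pos_of_nonneg_of_lt_of_locally_strictly_pseudomonotone hI hne hloc hy hx hlt hys hxs hys0
    exact absurd h (not_le.2 (mul_neg_of_pos_of_neg this (sub_neg.2 hlt)))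
end

section
/- Let I ⊆ ℝ be an interval and let F : I ⇒ ℝ be a lower semicontinuous set-valued function with F(x) ≠ ∅ for all x ∈ I. Let J ⊆ I be dense in I and assume that F is locally strictly quasimonotone on J. Assume further that 0 ∉ F(x) for all x ∈ I ∖ J. Then F is strictly quasimonotone on I. -/
open Set Filter

/-- A lower semicontinuous set-valued function that meets an open set at `x` also meets it at all
points of `I` within some positive distance of `x`. -/
theorem SVLscOn.exists_forall_abs_sub_lt {F : ℝ → Set ℝ} {I N : Set ℝ} (hF : SVLscOn F I)
    (hN : IsOpen N) {x : ℝ} (hx : x ∈ I) (h : (F x ∩ N).Nonempty) :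
    ∃ ε > 0, ∀ y ∈ I, |y - x| < ε → (F y ∩ N).Nonempty := by
  obtain ⟨M, hM, hMI⟩ := hF x hx N hN h
  obtain ⟨ε, hε, hball⟩ := Metric.mem_nhds_iff.1 hM
  exact ⟨ε, hε, fun y hy hyx => hMI y ⟨hball (by rwa [Metric.mem_ball, Real.dist_eq]), hy⟩⟩

theorem IsOpen.exists_forall_abs_sub_lt {U : Set ℝ} (hU : IsOpen U) {x : ℝ} (hx : x ∈ U) :
    ∃ ε > 0, ∀ y, |y - x| < ε → y ∈ U := by
  obtain ⟨ε, hε, hball⟩ := Metric.isOpen_iff.1 hU x hx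
  exact ⟨ε, hε, fun y hyx => hball (by rwa [Metric.mem_ball, Real.dist_eq])⟩

/-- A subset dense in an interval meets every open interval between points of the interval. -/
theorem Set.OrdConnected.exists_mem_between {I J : Set ℝ} (hI : I.OrdConnected)
    (hJ : I ⊆ closure J) {a b c d : ℝ} (ha : a ∈ I) (hb : b ∈ I) (hac : a ≤ c) (hcd : c < d)
    (hdb : d ≤ b) : ∃ j ∈ J, c < j ∧ j < d := by
  have hm : (c + d) / 2 ∈ closure J := hJ (hI.out ha hb ⟨by linarith, by linarith⟩)
  obtain ⟨j, hj, hjJ⟩ := mem_closure_iff.1 hm (Ioo c d) isOpen_Ioo ⟨by linarith, by linarith⟩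
  exact ⟨j, hjJ, hj.1, hj.2⟩

/-- In the open part `U` of an interval, no positive value of `F` lies to the left of a negative
one, provided that `F` is quasimonotone on the trace of a dense set on `U`. -/
theorem SVQuasimonotoneOn.not_pos_neg_of_dense {F : ℝ → Set ℝ} {I J U : Set ℝ}
    (hI : I.OrdConnected) (hlsc : SVLscOn F I) (hJI : J ⊆ I) (hdense : I ⊆ closure J)
    (hU : IsOpen U) (hq : SVQuasimonotoneOn F (U ∩ J)) {a b : ℝ} (ha : a ∈ I) (hb : b ∈ I)
    (haU : a ∈ U) (hbU : b ∈ U) (hab : a < b) (hpos : (F a ∩ Ioi 0).Nonempty)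
    (hneg : (F b ∩ Iio 0).Nonempty) : False := by
  obtain ⟨ε₁, hε₁, h₁⟩ := hlsc.exists_forall_abs_sub_lt isOpen_Ioi ha hpos
  obtain ⟨ε₂, hε₂, h₂⟩ := hlsc.exists_forall_abs_sub_lt isOpen_Iio hb hneg
  obtain ⟨δ₁, hδ₁, hU₁⟩ := hU.exists_forall_abs_sub_lt haU
  obtain ⟨δ₂, hδ₂, hU₂⟩ := hU.exists_forall_abs_sub_lt hbU
  obtain ⟨η, hη, hη'⟩ : ∃ η > 0, η ≤ ε₁ ∧ η ≤ ε₂ ∧ η ≤ δ₁ ∧ η ≤ δ₂ ∧ η ≤ (b - a) / 2 :=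
    ⟨min ε₁ (min ε₂ (min δ₁ (min δ₂ ((b - a) / 2)))), by simp [*], by simp⟩
  obtain ⟨i, hi, hai, hia⟩ :=
    hI.exists_mem_between hdense ha hb le_rfl (show a < a + η by linarith) (by linarith)
  obtain ⟨j, hj, hbj, hjb⟩ :=
    hI.exists_mem_between hdense ha hb (by linarith) (show b - η < b by linarith) le_rfl
  have hi' : |i - a| < η := abs_lt.2 ⟨by linarith, by linarith⟩
  have hj' : |j - b| < η := abs_lt.2 ⟨by linarith, by linarith⟩
  obtain ⟨p, hp, hp0⟩ := h₁ i (hJI hi) (by linarith)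
  obtain ⟨n, hn, hn0⟩ := h₂ j (hJI hj) (by linarith)
  have hij : 0 < j - i := by linarith
  have := hq i ⟨hU₁ i (by linarith), hi⟩ j ⟨hU₂ j (by linarith), hj⟩ p hp n hn (mul_pos hp0 hij)
  exact this.not_gt (mul_neg_of_neg_of_pos hn0 hij)

/-- A lower semicontinuous set-valued function on an interval `I ⊆ ℝ` which is locally strictly
quasimonotone on a dense subset `J ⊆ I` and satisfies `0 ∉ F x` for all `x ∈ I \ J` is
strictly quasimonotone on `I`. -/
theorem strictly_quasimonotone_of_dense
    (I : Set ℝ) (hI : I.OrdConnected) (F : ℝ → Set ℝ)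
    (hne : ∀ x ∈ I, (F x).Nonempty)
    (hlsc : SVLscOn F I)
    (J : Set ℝ) (hJI : J ⊆ I) (hdense : I ⊆ closure J)
    (hloc : ∀ x ∈ J, ∃ U : Set ℝ, IsOpen U ∧ x ∈ U ∧ SVStrictlyQuasimonotoneOn F (U ∩ J))
    (hzero : ∀ x ∈ I \ J, (0 : ℝ) ∉ F x) :
    SVStrictlyQuasimonotoneOn F I := by
  have hpoint : ∀ a ∈ I, ∀ b ∈ I, a < b → ∀ x ∈ I, a ≤ x → x ≤ b →
      (F x ∩ Ioi 0).Nonempty → (F x ∩ Iio 0).Nonempty → False := by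
    intro a ha b hb hab x hx hax hxb hpos hneg
    obtain ⟨ε₁, hε₁, h₁⟩ := hlsc.exists_forall_abs_sub_lt isOpen_Ioi hx hpos
    obtain ⟨ε₂, hε₂, h₂⟩ := hlsc.exists_forall_abs_sub_lt isOpen_Iio hx hneg
    obtain ⟨η, hη, hη₁, hη₂⟩ : ∃ η > 0, η ≤ ε₁ ∧ η ≤ ε₂ := ⟨min ε₁ ε₂, by simp [*], by simp⟩
    obtain ⟨j, hj, hlj, hju⟩ := hI.exists_mem_between hdense ha hb (le_max_left a (x - η))
      (show max a (x - η) < min b (x + η) by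
        simp only [max_lt_iff, lt_min_iff]
        exact ⟨⟨hab, by linarith⟩, by linarith, by linarith⟩) (min_le_left _ _)
    rw [max_lt_iff] at hlj
    rw [lt_min_iff] at hju
    obtain ⟨U, hU, hjU, hq, -⟩ := hloc j hj
    obtain ⟨δ, hδ, hUδ⟩ := hU.exists_forall_abs_sub_lt hjU
    obtain ⟨k, hk, hjk, hkj⟩ := hI.exists_mem_between hdense ha hb hlj.1.le
      (show j < min (j + δ) (min b (x + η)) by simp [*])
      ((min_le_right _ _).trans (min_le_left _ _))
    simp only [lt_min_iff] at hkj
    have hjx : |j - x| < η := abs_lt.2 ⟨by linarith, by linarith⟩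
    have hkx : |k - x| < η := abs_lt.2 ⟨by linarith, by linarith⟩
    exact hq.not_pos_neg_of_dense hI hlsc hJI hdense hU (hJI hj) (hJI hk) hjU
      (hUδ k (abs_lt.2 ⟨by linarith, by linarith⟩)) hjk (h₁ j (hJI hj) (by linarith))
      (h₂ k (hJI hk) (by linarith))
  have hnonzero : ∀ a ∈ I, ∀ b ∈ I, a < b → ∃ z ∈ I, a < z ∧ z < b ∧ ∃ w ∈ F z, w ≠ 0 := by
    intro a ha b hb hab
    obtain ⟨j, hj, haj, hjb⟩ := hI.exists_mem_between hdense ha hb le_rfl hab le_rfl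
    obtain ⟨U, hU, hjU, -, hs⟩ := hloc j hj
    obtain ⟨δ, hδ, hUδ⟩ := hU.exists_forall_abs_sub_lt hjU
    obtain ⟨k, hk, hjk, hkj⟩ := hI.exists_mem_between hdense ha hb haj.le
      (show j < min (j + δ) b by simp [*]) (min_le_right _ _)
    rw [lt_min_iff] at hkj
    obtain ⟨z, hz, hzJ, w, hw, hw0⟩ := hs j ⟨hjU, hj⟩ k
      ⟨hUδ k (abs_lt.2 ⟨by linarith, by linarith⟩), hk⟩ hjk.ne
    rw [openSegment_eq_Ioo hjk] at hz
    exact ⟨z, hJI hzJ.2, haj.trans hz.1, hz.2.trans hkj.2, w, hw, left_ne_zero_of_mul hw0⟩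
  have hglobal : ∀ a ∈ I, ∀ b ∈ I, a < b → (F a ∩ Ioi 0).Nonempty →
      (F b ∩ Iio 0).Nonempty → False := by
    intro a ha b hb hab hpos hneg
    set S : Set ℝ := {t | t ∈ Icc a b ∧ (F t ∩ Ioi 0).Nonempty}
    have haS : a ∈ S := ⟨⟨le_rfl, hab.le⟩, hpos⟩
    have hlub : IsLUB S (sSup S) := isLUB_csSup ⟨a, haS⟩ ⟨b, fun t ht => ht.1.2⟩
    set c := sSup S
    have hac : a ≤ c := hlub.1 haS
    have hcb : c ≤ b := hlub.2 fun t ht => ht.1.2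
    have hcI : c ∈ I := hI.out ha hb ⟨hac, hcb⟩
    have hcpos : ¬(F c ∩ Ioi 0).Nonempty := by
      intro hc
      have hcb' : c < b := hcb.lt_of_ne fun h =>
        hpoint a ha b hb hab b hb hab.le le_rfl (h ▸ hc) hneg
      obtain ⟨ε, hε, h⟩ := hlsc.exists_forall_abs_sub_lt isOpen_Ioi hcI hc
      obtain ⟨j, hj, hcj, hjc⟩ := hI.exists_mem_between hdense ha hb hac
        (show c < min b (c + ε) by simp [*]) (min_le_left _ _)
      rw [lt_min_iff] at hjc
      exact hcj.not_ge (hlub.1 ⟨⟨by linarith, hjc.1.le⟩,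
        h j (hJI hj) (abs_lt.2 ⟨by linarith, by linarith⟩)⟩)
    have hcneg : ¬(F c ∩ Iio 0).Nonempty := by
      intro hc
      obtain ⟨ε, hε, h⟩ := hlsc.exists_forall_abs_sub_lt isOpen_Iio hcI hc
      obtain ⟨t, ht, htc, htc'⟩ := hlub.exists_between (show c - ε < c by linarith)
      have htI : t ∈ I := hI.out ha hb ht.1
      exact hpoint a ha b hb hab t htI ht.1.1 ht.1.2 ht.2
        (h t htI (abs_lt.2 ⟨by linarith, by linarith⟩))
    have hcJ : c ∈ J := by
      by_contra hc
      obtain ⟨w, hw⟩ := hne c hcI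
      rcases lt_trichotomy w 0 with h | rfl | h
      · exact hcneg ⟨w, hw, h⟩
      · exact hzero c ⟨hcI, hc⟩ hw
      · exact hcpos ⟨w, hw, h⟩
    have hcb' : c < b := hcb.lt_of_ne fun h => hcneg (h ▸ hneg)
    obtain ⟨U, hU, hcU, hq, -⟩ := hloc c hcJ
    obtain ⟨δ, hδ, hUδ⟩ := hU.exists_forall_abs_sub_lt hcU
    obtain ⟨t, ht, htc, htc'⟩ := hlub.exists_between (show c - δ < c by linarith)
    have hlt : c < min b (c + δ) := by simp [*]
    obtain ⟨z, hzI, hcz, hzm, w, hw, hw0⟩ := hnonzero c hcI (min b (c + δ))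
      (hI.out hcI hb ⟨hlt.le, min_le_left _ _⟩) hlt
    rw [lt_min_iff] at hzm
    have hwneg : w < 0 := by
      refine hw0.lt_of_le (not_lt.1 fun h =>
        hcz.not_ge (hlub.1 ⟨⟨by linarith, hzm.1.le⟩, w, hw, h⟩))
    have htc'' : t < c := htc'.lt_of_ne fun h => hcpos (h ▸ ht.2)
    exact hq.not_pos_neg_of_dense hI hlsc hJI hdense hU (hI.out ha hb ht.1) hzI
      (hUδ t (abs_lt.2 ⟨by linarith, by linarith⟩))
      (hUδ z (abs_lt.2 ⟨by linarith, by linarith⟩)) (htc''.trans hcz) ht.2 ⟨w, hw, hwneg⟩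
  refine ⟨fun x hx y hy p hp q hq hpos => not_lt.1 fun hneg => ?_, fun x hx y hy hxy => ?_⟩
  · rcases lt_trichotomy x y with h | rfl | h
    · have h' : 0 < y - x := sub_pos.2 h
      exact hglobal x hx y hy h ⟨p, hp, pos_of_mul_pos_left hpos h'.le⟩
        ⟨q, hq, neg_of_mul_neg_left hneg h'.le⟩
    · simp at hpos
    · have h' : y - x < 0 := sub_neg.2 h
      exact hglobal y hy x hx h ⟨q, hq, pos_of_mul_neg_left hneg h'.le⟩
        ⟨p, hp, neg_of_mul_pos_left hpos h'.le⟩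
  · rcases hxy.lt_or_gt with h | h
    · obtain ⟨z, hz, hxz, hzy, w, hw, hw0⟩ := hnonzero x hx y hy h
      exact ⟨z, openSegment_eq_Ioo h ▸ ⟨hxz, hzy⟩, hz, w, hw, mul_ne_zero hw0 (sub_ne_zero.2 h.ne')⟩
    · obtain ⟨z, hz, hyz, hzx, w, hw, hw0⟩ := hnonzero y hy x hx h
      exact ⟨z, openSegment_symm ℝ y x ▸ openSegment_eq_Ioo h ▸ ⟨hyz, hzx⟩, hz, w, hw,
        mul_ne_zero hw0 (sub_ne_zero.2 h.ne)⟩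
end

section
/- Let I ⊆ ℝ be an interval and F : I ⇒ ℝ a set-valued function with F(x) ≠ ∅ for all x ∈ I. (i) If I is closed from the left with left endpoint x, all elements of F(x) are ≥ 0, and all elements of F(y) are > 0 for all y ∈ I with y > x, then F is strictly pseudomonotone on I. (ii) If I is closed from the right with right endpoint x, all elements of F(x) are ≤ 0, and all elements of F(y) are < 0 for all y ∈ I with y < x, then F is strictly pseudomonotone on I. -/
open Set Filter

/-- (i) If `I` is closed from the left with left endpoint `x`, `F x ≥ 0` and `F y > 0` for all
`y ∈ I`, `y > x`, then `F` is strictly pseudomonotone on `I`.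
(ii) If `I` is closed from the right with right endpoint `x`, `F x ≤ 0` and `F y < 0` for all
`y ∈ I`, `y < x`, then `F` is strictly pseudomonotone on `I`. -/
theorem strictly_pseudomonotone_of_endpoint
    (I : Set ℝ) (hI : I.OrdConnected) (F : ℝ → Set ℝ)
    (hne : ∀ x ∈ I, (F x).Nonempty) :
    (∀ x ∈ I, (∀ y ∈ I, x ≤ y) → (∀ xs ∈ F x, 0 ≤ xs) →
      (∀ y ∈ I, x < y → ∀ ys ∈ F y, 0 < ys) → SVStrictlyPseudomonotoneOn F I) ∧
    (∀ x ∈ I, (∀ y ∈ I, y ≤ x) → (∀ xs ∈ F x, xs ≤ 0) →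
      (∀ y ∈ I, y < x → ∀ ys ∈ F y, ys < 0) → SVStrictlyPseudomonotoneOn F I) := by
  constructor
  · intro x _ hle _ hpos a ha b hb hab as has bs hbs h
    rcases lt_or_gt_of_ne hab with hlt | hgt
    · exact mul_pos (hpos b hb ((hle a ha).trans_lt hlt) bs hbs) (sub_pos.2 hlt)
    · exact absurd h (mul_neg_of_pos_of_neg
        (hpos a ha ((hle b hb).trans_lt hgt) as has) (sub_neg.2 hgt)).not_ge
  · intro x _ hle _ hneg a ha b hb hab as has bs hbs h
    rcases lt_or_gt_of_ne hab with hlt | hgt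
    · exact absurd h (mul_neg_of_neg_of_pos
        (hneg a ha (hlt.trans_le (hle b hb)) as has) (sub_pos.2 hlt)).not_ge
    · exact mul_pos_of_neg_of_neg (hneg b hb (hgt.trans_le (hle a ha)) bs hbs) (sub_neg.2 hgt)
end

section
/- Let I ⊆ ℝ be an interval and let F : I ⇒ ℝ be a lower semicontinuous set-valued function with F(x) ≠ ∅ for all x ∈ I. Let J ⊆ I be dense in I and assume that F is locally pseudomonotone on J. Assume further that 0 ∉ F(x) for all x ∈ I ∖ J. Then F is pseudomonotone on I. -/
open Set Filter

/-- The sign condition expressing pseudomonotonicity for an ordered pair of points. -/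
def SVSignLE (F : ℝ → Set ℝ) (s t : ℝ) : Prop :=
  s < t → ∀ v ∈ F s, ∀ w ∈ F t, (0 ≤ v → 0 ≤ w) ∧ (0 < v → 0 < w)

theorem SVSignLE.trans {F : ℝ → Set ℝ} {s m t : ℝ} (hsm : s ≤ m) (hmt : m ≤ t)
    (hne : (F m).Nonempty) (h₁ : SVSignLE F s m) (h₂ : SVSignLE F m t) : SVSignLE F s t := by
  rcases hsm.eq_or_lt with rfl | hsm
  · exact h₂
  rcases hmt.eq_or_lt with rfl | hmt
  · exact h₁
  obtain ⟨u, hu⟩ := hne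
  intro _ v hv w hw
  have h₃ := h₁ hsm v hv u hu
  have h₄ := h₂ hmt u hu w hw
  exact ⟨fun h => h₄.1 (h₃.1 h), fun h => h₄.2 (h₃.2 h)⟩

theorem SVPseudomonotoneOn.signLE {F : ℝ → Set ℝ} {S : Set ℝ} (h : SVPseudomonotoneOn F S)
    {s t : ℝ} (hs : s ∈ S) (ht : t ∈ S) : SVSignLE F s t := by
  intro hst v hv w hw
  refine ⟨fun h0 => ?_, fun h0 => ?_⟩
  · have := h s hs t ht v hv w hw (mul_nonneg h0 (sub_nonneg.2 hst.le))
    exact nonneg_of_mul_nonneg_left this (sub_pos.2 hst)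
  · by_contra! hw0
    have := h t ht s hs w hw v hv (mul_nonneg_of_nonpos_of_nonpos hw0 (sub_nonpos.2 hst.le))
    nlinarith [mul_pos h0 (sub_pos.2 hst)]

theorem svPseudomonotoneOn_of_signLE {F : ℝ → Set ℝ} {S : Set ℝ}
    (h : ∀ s ∈ S, ∀ t ∈ S, SVSignLE F s t) : SVPseudomonotoneOn F S := by
  intro x hx y hy v hv w hw hvw
  rcases lt_trichotomy x y with hxy | rfl | hxy
  · have hv0 : 0 ≤ v := nonneg_of_mul_nonneg_left hvw (sub_pos.2 hxy)
    exact mul_nonneg ((h x hx y hy hxy v hv w hw).1 hv0) (sub_nonneg.2 hxy.le)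
  · simp
  · have hw0 : w ≤ 0 := by
      by_contra! hw0
      have := (h y hy x hx hxy w hw v hv).2 hw0
      nlinarith [mul_pos this (sub_pos.2 hxy)]
    exact mul_nonneg_of_nonpos_of_nonpos hw0 (sub_nonpos.2 hxy.le)

/-- On an interval, the sign condition is a local property. -/
theorem svSignLE_of_local {F : ℝ → Set ℝ} {I : Set ℝ} (hI : I.OrdConnected)
    (hne : ∀ x ∈ I, (F x).Nonempty)
    (hloc : ∀ x ∈ I, ∃ U : Set ℝ, IsOpen U ∧ x ∈ U ∧
      ∀ s ∈ U ∩ I, ∀ t ∈ U ∩ I, SVSignLE F s t) :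
    ∀ s ∈ I, ∀ t ∈ I, SVSignLE F s t := by
  intro a ha b hb hab
  have hsub : ∀ x : Icc a b, (x : ℝ) ∈ I := fun x => hI.out ha hb x.2
  choose U hUo hxU hU using fun x : Icc a b => hloc x (hsub x)
  obtain ⟨τ, hτ0, hmono, ⟨m, hm⟩, hτ⟩ := exists_monotone_Icc_subset_open_cover_Icc hab.le
    (c := fun x => Subtype.val ⁻¹' U x) (fun x => (hUo x).preimage continuous_subtype_val)
    (fun x _ => mem_iUnion.2 ⟨x, hxU x⟩)
  have key : ∀ n, SVSignLE F a (τ n) := by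
    intro n
    induction n with
    | zero => rw [hτ0]; exact fun h => absurd h (lt_irrefl _)
    | succ n ih =>
      obtain ⟨i, hi⟩ := hτ n
      have hle : τ n ≤ τ (n + 1) := hmono n.le_succ
      exact ih.trans (τ n).2.1 hle (hne _ (hsub _))
        (hU i _ ⟨hi (left_mem_Icc.2 hle), hsub _⟩ _ ⟨hi (right_mem_Icc.2 hle), hsub _⟩)
  have := key m
  rw [hm m le_rfl] at this
  exact this hab

/-- Values of `F` of a given sign persist at points of the dense set `J`. -/
theorem SVLscOn.exists_mem_dense {F : ℝ → Set ℝ} {I J : Set ℝ} (hlsc : SVLscOn F I)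
    (hJI : J ⊆ I) (hdense : I ⊆ closure J) (hzero : ∀ x ∈ I \ J, (0 : ℝ) ∉ F x)
    {s : ℝ} (hs : s ∈ I) {O : Set ℝ} (hO : O ∈ nhds s) {N : Set ℝ} (hN : IsOpen (N \ {0}))
    {v : ℝ} (hv : v ∈ F s) (hvN : v ∈ N) : ∃ r ∈ J ∩ O, ∃ w ∈ F r, w ∈ N := by
  by_cases hsJ : s ∈ J
  · exact ⟨s, ⟨hsJ, mem_of_mem_nhds hO⟩, v, hv, hvN⟩
  have hv0 : v ≠ 0 := fun h => hzero s ⟨hs, hsJ⟩ (h ▸ hv)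
  obtain ⟨M, hM, hMF⟩ := hlsc s hs _ hN ⟨v, hv, hvN, hv0⟩
  obtain ⟨r, ⟨hrO, hrM⟩, hrJ⟩ := mem_closure_iff_nhds.1 (hdense hs) _ (inter_mem hO hM)
  obtain ⟨w, hw, hwN⟩ := hMF r ⟨hrM, hJI hrJ⟩
  exact ⟨r, ⟨hrJ, hrO⟩, w, hw, hwN.1⟩

theorem exists_mem_Ioo_of_dense {I J : Set ℝ} (hI : I.OrdConnected) (hdense : I ⊆ closure J)
    {s t c : ℝ} (hs : s ∈ I) (ht : t ∈ I) (hst : s < t) (hc : c ∈ Icc s t)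
    {O : Set ℝ} (hO : O ∈ nhds c) : ∃ r ∈ J ∩ O, r ∈ Ioo s t := by
  rw [← closure_Ioo hst.ne] at hc
  obtain ⟨p, hpO, hp⟩ := mem_closure_iff_nhds.1 hc _ (interior_mem_nhds.2 hO)
  obtain ⟨r, ⟨hrO, hr⟩, hrJ⟩ := mem_closure_iff_nhds.1 (hdense (hI.out hs ht ⟨hp.1.le, hp.2.le⟩)) _
    (inter_mem (isOpen_interior.mem_nhds hpO) (Ioo_mem_nhds hp.1 hp.2))
  exact ⟨r, ⟨hrJ, interior_subset hrO⟩, hr⟩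

theorem Ioi_diff_zero_isOpen : IsOpen (Ioi (0 : ℝ) \ {0}) := isOpen_Ioi.sdiff isClosed_singleton

theorem Iio_diff_zero_isOpen : IsOpen (Iio (0 : ℝ) \ {0}) := isOpen_Iio.sdiff isClosed_singleton

theorem Ici_diff_zero_isOpen : IsOpen (Ici (0 : ℝ) \ {0}) := by
  rw [Ici_sdiff_left]; exact isOpen_Ioi

theorem Iic_diff_zero_isOpen : IsOpen (Iic (0 : ℝ) \ {0}) := by
  rw [Iic_sdiff_right]; exact isOpen_Iio

/-- The sign condition on a neighborhood extends from a dense set `J` to `I`. -/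
theorem SVLscOn.signLE_of_dense {F : ℝ → Set ℝ} {I J : Set ℝ} (hlsc : SVLscOn F I)
    (hJI : J ⊆ I) (hdense : I ⊆ closure J) (hzero : ∀ x ∈ I \ J, (0 : ℝ) ∉ F x)
    {U : Set ℝ} (hUo : IsOpen U) (hU : SVPseudomonotoneOn F (U ∩ J)) {s t : ℝ}
    (hs : s ∈ U ∩ I) (ht : t ∈ U ∩ I) : SVSignLE F s t := by
  intro hst v hv w hw
  obtain ⟨m, hsm, hmt⟩ := exists_between hst
  have approx : ∀ N N' : Set ℝ, IsOpen (N \ {0}) → IsOpen (N' \ {0}) → v ∈ N → w ∈ N' →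
      ∃ v' ∈ N, ∃ w' ∈ N', (0 ≤ v' → 0 ≤ w') ∧ (0 < v' → 0 < w') := by
    intro N N' hN hN' hvN hwN
    obtain ⟨p, ⟨hpJ, hpU, hpm⟩, v', hv', hvN'⟩ := hlsc.exists_mem_dense hJI hdense hzero hs.2
      (inter_mem (hUo.mem_nhds hs.1) (Iio_mem_nhds hsm)) hN hv hvN
    obtain ⟨q, ⟨hqJ, hqU, hqm⟩, w', hw', hwN'⟩ := hlsc.exists_mem_dense hJI hdense hzero ht.2
      (inter_mem (hUo.mem_nhds ht.1) (Ioi_mem_nhds hmt)) hN' hw hwN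
    exact ⟨v', hvN', w', hwN', hU.signLE ⟨hpU, hpJ⟩ ⟨hqU, hqJ⟩ (lt_trans hpm hqm) v' hv' w' hw'⟩
  refine ⟨fun h0 => ?_, fun h0 => ?_⟩ <;> by_contra! hw0
  · obtain ⟨v', hv', w', hw', h, -⟩ :=
      approx _ _ Ici_diff_zero_isOpen Iio_diff_zero_isOpen h0 hw0
    exact absurd (h hv') (not_le.2 hw')
  · obtain ⟨v', hv', w', hw', -, h⟩ :=
      approx _ _ Ioi_diff_zero_isOpen Iic_diff_zero_isOpen h0 hw0
    exact absurd (h hv') (not_lt.2 hw')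

/-- A lower semicontinuous set-valued function on an interval `I ⊆ ℝ` which is locally
pseudomonotone on a dense subset `J ⊆ I` and satisfies `0 ∉ F x` for all `x ∈ I \ J` is
pseudomonotone on `I`. -/
theorem pseudomonotone_of_dense
    (I : Set ℝ) (hI : I.OrdConnected) (F : ℝ → Set ℝ)
    (hne : ∀ x ∈ I, (F x).Nonempty)
    (hlsc : SVLscOn F I)
    (J : Set ℝ) (hJI : J ⊆ I) (hdense : I ⊆ closure J)
    (hloc : ∀ x ∈ J, ∃ U : Set ℝ, IsOpen U ∧ x ∈ U ∧ SVPseudomonotoneOn F (U ∩ J))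
    (hzero : ∀ x ∈ I \ J, (0 : ℝ) ∉ F x) :
    SVPseudomonotoneOn F I := by
  refine svPseudomonotoneOn_of_signLE (svSignLE_of_local hI hne fun x hx => ?_)
  by_cases hxJ : x ∈ J
  · obtain ⟨U, hUo, hxU, hU⟩ := hloc x hxJ
    exact ⟨U, hUo, hxU, fun s hs t ht => hlsc.signLE_of_dense hJI hdense hzero hUo hU hs ht⟩
  obtain ⟨v, hv⟩ := hne x hx
  have hv0 : v ≠ 0 := fun h => hzero x ⟨hx, hxJ⟩ (h ▸ hv)
  rcases hv0.lt_or_gt with hv0 | hv0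
  · obtain ⟨M, hM, hMF⟩ := hlsc x hx _ isOpen_Iio ⟨v, hv, hv0⟩
    obtain ⟨ε, hε, hball⟩ := Metric.mem_nhds_iff.1 hM
    refine ⟨_, Metric.isOpen_ball, Metric.mem_ball_self hε, fun s hs t ht hst => ?_⟩
    have hord : Icc s t ⊆ M := by
      refine Subset.trans ?_ hball
      rw [Real.ball_eq_Ioo] at hs ht ⊢
      exact Icc_subset_Ioo hs.1.1 ht.1.2
    have neg : ∀ p ∈ J, s ≤ p → p < t → ∀ u ∈ F p, u < 0 := by
      intro p hpJ hsp hpt u hu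
      obtain ⟨V, hVo, hpV, hV⟩ := hloc p hpJ
      obtain ⟨r, ⟨hrJ, hrV⟩, hr⟩ := exists_mem_Ioo_of_dense hI hdense (hJI hpJ) ht.2 hpt
        (left_mem_Icc.2 hpt.le) (hVo.mem_nhds hpV)
      obtain ⟨w, hw, hw0⟩ := hMF r ⟨hord ⟨hsp.trans hr.1.le, hr.2.le⟩, hJI hrJ⟩
      by_contra! hu0
      exact absurd ((hV.signLE ⟨hpV, hpJ⟩ ⟨hrV, hrJ⟩ hr.1 u hu w hw).1 hu0) (not_le.2 hw0)
    have neg' : ∀ u ∈ F s, u < 0 := by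
      intro u hu
      by_contra! hu0
      by_cases hsJ : s ∈ J
      · exact absurd (neg s hsJ le_rfl hst u hu) (not_lt.2 hu0)
      have hu1 : 0 < u := lt_of_le_of_ne hu0 fun h => hzero s ⟨hs.2, hsJ⟩ (h ▸ hu)
      obtain ⟨W, hW, hWF⟩ := hlsc s hs.2 _ isOpen_Ioi ⟨u, hu, hu1⟩
      obtain ⟨r, ⟨hrJ, hrW⟩, hr⟩ := exists_mem_Ioo_of_dense hI hdense hs.2 ht.2 hst
        (left_mem_Icc.2 hst.le) hW
      obtain ⟨w, hw, hw0⟩ := hWF r ⟨hrW, hJI hrJ⟩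
      exact lt_asymm hw0 (neg r hrJ hr.1.le hr.2 w hw)
    exact fun u hu w _ => ⟨fun h => absurd (neg' u hu) (not_lt.2 h),
      fun h => absurd (neg' u hu) (lt_asymm h)⟩
  · obtain ⟨M, hM, hMF⟩ := hlsc x hx _ isOpen_Ioi ⟨v, hv, hv0⟩
    obtain ⟨ε, hε, hball⟩ := Metric.mem_nhds_iff.1 hM
    refine ⟨_, Metric.isOpen_ball, Metric.mem_ball_self hε, fun s hs t ht hst => ?_⟩
    have hord : Icc s t ⊆ M := by
      refine Subset.trans ?_ hball
      rw [Real.ball_eq_Ioo] at hs ht ⊢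
      exact Icc_subset_Ioo hs.1.1 ht.1.2
    have pos : ∀ p ∈ J, s < p → p ≤ t → ∀ u ∈ F p, 0 < u := by
      intro p hpJ hsp hpt u hu
      obtain ⟨V, hVo, hpV, hV⟩ := hloc p hpJ
      obtain ⟨r, ⟨hrJ, hrV⟩, hr⟩ := exists_mem_Ioo_of_dense hI hdense hs.2 (hJI hpJ) hsp
        (right_mem_Icc.2 hsp.le) (hVo.mem_nhds hpV)
      obtain ⟨w, hw, hw0⟩ := hMF r ⟨hord ⟨hr.1.le, hr.2.le.trans hpt⟩, hJI hrJ⟩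
      exact (hV.signLE ⟨hrV, hrJ⟩ ⟨hpV, hpJ⟩ hr.2 w hw u hu).2 hw0
    have pos' : ∀ u ∈ F t, 0 < u := by
      intro u hu
      by_contra! hu0
      by_cases htJ : t ∈ J
      · exact absurd (pos t htJ hst le_rfl u hu) (not_lt.2 hu0)
      have hu1 : u < 0 := lt_of_le_of_ne hu0 fun h => hzero t ⟨ht.2, htJ⟩ (h ▸ hu)
      obtain ⟨W, hW, hWF⟩ := hlsc t ht.2 _ isOpen_Iio ⟨u, hu, hu1⟩
      obtain ⟨r, ⟨hrJ, hrW⟩, hr⟩ := exists_mem_Ioo_of_dense hI hdense hs.2 ht.2 hst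
        (right_mem_Icc.2 hst.le) hW
      obtain ⟨w, hw, hw0⟩ := hWF r ⟨hrW, hJI hrJ⟩
      exact lt_asymm hw0 (pos r hrJ hr.1 hr.2.le w hw)
    exact fun _ _ w hw => ⟨fun _ => (pos' w hw).le, fun _ => pos' w hw⟩
end

section
/- Let I ⊆ ℝ be an interval and let F : I ⇒ ℝ be a lower semicontinuous set-valued function with F(x) ≠ ∅ for all x ∈ I. Let J ⊆ I be dense in I and assume that F is locally strictly pseudomonotone on J. Assume further that 0 ∉ F(x) for all x ∈ I ∖ J. Then F is strictly pseudomonotone on I. -/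
open Set Filter

/-- Having the same strict sign is transitive. -/
theorem mul_pos_trans {a b c : ℝ} (hab : 0 < a * b) (hbc : 0 < b * c) : 0 < a * c := by
  have h : 0 < a * c * (b * b) := by linarith [mul_pos hab hbc]
  exact pos_of_mul_pos_left h (mul_self_nonneg b)

/-- A set dense in an order-connected `I ⊆ ℝ` meets every neighborhood of `p ∈ I` strictly between
`p` and any other point `q ∈ I`. -/
theorem exists_mem_dense_between {I J : Set ℝ} (hI : I.OrdConnected) (hdense : I ⊆ closure J)
    {p q : ℝ} (hp : p ∈ I) (hq : q ∈ I) (hpq : p ≠ q) {O : Set ℝ} (hO : O ∈ nhds p) :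
    ∃ j ∈ J, j ∈ O ∧ 0 < (j - p) * (q - j) := by
  obtain ⟨ε, hε, hball⟩ := Metric.mem_nhds_iff.1 hO
  have key : ∀ m r : ℝ, m ∈ I → 0 < r → |m - p| + r ≤ ε →
      (∀ j, |j - m| < r → 0 < (j - p) * (q - j)) → ∃ j ∈ J, j ∈ O ∧ 0 < (j - p) * (q - j) := by
    intro m r hm hr hmr h
    obtain ⟨j, hj, hjm⟩ := Metric.mem_closure_iff.1 (hdense hm) r hr
    rw [dist_comm, Real.dist_eq] at hjm
    refine ⟨j, hj, hball ?_, h j hjm⟩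
    rw [Metric.mem_ball, Real.dist_eq]
    linarith [abs_sub_le j m p]
  rcases lt_or_gt_of_ne hpq with h | h
  · have hr : 0 < min ε (q - p) / 2 := half_pos (lt_min hε (sub_pos.2 h))
    have h₁ := min_le_left ε (q - p)
    have h₂ := min_le_right ε (q - p)
    refine key (p + min ε (q - p) / 2) (min ε (q - p) / 2)
      (hI.out hp hq ⟨by linarith, by linarith⟩) hr ?_ fun j hj => ?_
    · rw [add_sub_cancel_left, abs_of_pos hr]; linarith
    · rw [abs_lt] at hj
      exact mul_pos (by linarith) (by linarith)
  · have hr : 0 < min ε (p - q) / 2 := half_pos (lt_min hε (sub_pos.2 h))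
    have h₁ := min_le_left ε (p - q)
    have h₂ := min_le_right ε (p - q)
    refine key (p - min ε (p - q) / 2) (min ε (p - q) / 2)
      (hI.out hq hp ⟨by linarith, by linarith⟩) hr ?_ fun j hj => ?_
    · rw [show p - min ε (p - q) / 2 - p = -(min ε (p - q) / 2) by ring, abs_neg,
        abs_of_pos hr]
      linarith
    · rw [abs_lt] at hj
      exact mul_pos_of_neg_of_neg (by linarith) (by linarith)

/-- Nonzero values of a lower semicontinuous set-valued function persist in sign nearby. -/
theorem SVLscOn.eventually_exists_mul_pos {F : ℝ → Set ℝ} {I : Set ℝ} (hlsc : SVLscOn F I)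
    {x a : ℝ} (hx : x ∈ I) (ha : a ∈ F x) (ha₀ : a ≠ 0) :
    ∀ᶠ y in nhds x, y ∈ I → ∃ b ∈ F y, 0 < a * b := by
  obtain ⟨M, hM, h⟩ := hlsc x hx {b | 0 < a * b}
    (isOpen_lt continuous_const (continuous_const.mul continuous_id))
    ⟨a, ha, mul_self_pos.2 ha₀⟩
  filter_upwards [hM] with y hy hyI
  exact h y ⟨hy, hyI⟩

/-- A lower semicontinuous function that is locally strictly pseudomonotone on a dense subset of a
nondegenerate interval takes no values of opposite signs at a single point. -/
theorem mul_nonneg_of_locally_strictlyPseudomonotone {F : ℝ → Set ℝ} {I J : Set ℝ}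
    (hI : I.OrdConnected) (hnt : I.Nontrivial) (hlsc : SVLscOn F I) (hJI : J ⊆ I)
    (hdense : I ⊆ closure J)
    (hloc : ∀ x ∈ J, ∃ U : Set ℝ, IsOpen U ∧ x ∈ U ∧ SVStrictlyPseudomonotoneOn F (U ∩ J))
    {p a b : ℝ} (hp : p ∈ I) (ha : a ∈ F p) (hb : b ∈ F p) : 0 ≤ a * b := by
  by_contra! hab
  have ha₀ : a ≠ 0 := left_ne_zero_of_mul hab.ne
  have hb₀ : b ≠ 0 := right_ne_zero_of_mul hab.ne
  have hev := ((hlsc.eventually_exists_mul_pos hp ha ha₀).and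
    (hlsc.eventually_exists_mul_pos hp hb hb₀)).eventually_nhds
  obtain ⟨q, hq, hqp⟩ := hnt.exists_ne p
  obtain ⟨j, hj, hjev, -⟩ := exists_mem_dense_between hI hdense hp hq hqp.symm hev
  obtain ⟨U, hU, hjU, hspm⟩ := hloc j hj
  obtain ⟨r, hr, hrj⟩ := hnt.exists_ne j
  obtain ⟨k, hk, ⟨hkev, hkU⟩, hbtw⟩ := exists_mem_dense_between hI hdense (hJI hj) hr hrj.symm
    (Filter.inter_mem hjev (hU.mem_nhds hjU))
  have hjk : j ≠ k := by
    rintro rfl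
    simp at hbtw
  obtain ⟨⟨c, hc, hac⟩, ⟨d, hd, hbd⟩⟩ :
      (∃ c ∈ F j, 0 < a * c) ∧ ∃ d ∈ F j, 0 < b * d :=
    ⟨hjev.self_of_nhds.1 (hJI hj), hjev.self_of_nhds.2 (hJI hj)⟩
  obtain ⟨⟨c', hc', hac'⟩, ⟨d', hd', hbd'⟩⟩ :
      (∃ c ∈ F k, 0 < a * c) ∧ ∃ d ∈ F k, 0 < b * d :=
    ⟨hkev.1 (hJI hk), hkev.2 (hJI hk)⟩
  have hopp : ∀ {e f : ℝ}, 0 < a * e → 0 < b * f → ¬ 0 < e * f := fun he hf hef =>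
    hab.not_gt (mul_pos_trans he (mul_pos_trans hef (mul_comm b _ ▸ hf)))
  have hcd : ∀ e ∈ F j, 0 ≤ e * (k - j) → False := fun e he h =>
    hopp hac' hbd' (mul_pos_trans (hspm j ⟨hjU, hj⟩ k ⟨hkU, hk⟩ hjk e he c' hc' h)
      (mul_comm d' (k - j) ▸ hspm j ⟨hjU, hj⟩ k ⟨hkU, hk⟩ hjk e he d' hd' h))
  have hc_neg : c * (k - j) < 0 := not_le.1 (hcd c hc)
  have hd_neg : d * (k - j) < 0 := not_le.1 (hcd d hd)
  refine hopp hac hbd (mul_pos_trans (b := -(k - j)) ?_ ?_) <;> linarith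

/-- Strict pseudomonotonicity holds between each point of `I` and its neighbors in `I`. -/
theorem eventually_mul_pos_of_locally_strictlyPseudomonotone {F : ℝ → Set ℝ} {I J : Set ℝ}
    (hI : I.OrdConnected) (hlsc : SVLscOn F I) (hJI : J ⊆ I) (hdense : I ⊆ closure J)
    (hloc : ∀ x ∈ J, ∃ U : Set ℝ, IsOpen U ∧ x ∈ U ∧ SVStrictlyPseudomonotoneOn F (U ∩ J))
    (hzero : ∀ x ∈ I \ J, (0 : ℝ) ∉ F x) {z a : ℝ} (hz : z ∈ I) (ha : a ∈ F z) :
    ∀ᶠ w in nhds z, w ∈ I → w ≠ z → 0 ≤ a * (w - z) → ∀ b ∈ F w, 0 < b * (w - z) := by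
  have hmem : ∀ w ∈ I, (0 : ℝ) ∈ F w → w ∈ J := fun w hw h₀ => by
    by_contra hwJ
    exact hzero w ⟨hw, hwJ⟩ h₀
  by_cases ha₀ : a = 0
  · subst ha₀
    have hzJ := hmem z hz ha
    obtain ⟨U, hU, hzU, hspm⟩ := hloc z hzJ
    filter_upwards [hU.mem_nhds hzU] with w hwU hw hwz _ b hb
    by_cases hwJ : w ∈ J
    · exact hspm z ⟨hzU, hzJ⟩ w ⟨hwU, hwJ⟩ hwz.symm 0 ha b hb (by simp)
    have hb₀ : b ≠ 0 := by
      rintro rfl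
      exact hwJ (hmem w hw hb)
    obtain ⟨j, hj, ⟨hjev, hjU⟩, hbtw⟩ := exists_mem_dense_between hI hdense hw hz hwz
      (Filter.inter_mem (hlsc.eventually_exists_mul_pos hw hb hb₀) (hU.mem_nhds hwU))
    obtain ⟨c, hc, hbc⟩ := hjev (hJI hj)
    have hjz : z ≠ j := by
      rintro rfl
      simp at hbtw
    have hpos := hspm z ⟨hzU, hzJ⟩ j ⟨hjU, hj⟩ hjz 0 ha c hc (by simp)
    have hsame : 0 < (j - z) * (w - z) := by nlinarith [sq_nonneg (j - z)]
    exact mul_pos_trans hbc (mul_pos_trans hpos hsame)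
  · obtain ⟨ε, hε, hball⟩ := Metric.eventually_nhds_iff.1 (hlsc.eventually_exists_mul_pos hz ha ha₀)
    refine Metric.eventually_nhds_iff.2 ⟨ε, hε, fun w hwε hw hwz haw b hb => ?_⟩
    have haw' : 0 < a * (w - z) :=
      haw.lt_of_ne' (mul_ne_zero ha₀ (sub_ne_zero.2 hwz))
    obtain ⟨c₀, hc₀, hac₀⟩ := hball hwε hw
    have hcb := mul_nonneg_of_locally_strictlyPseudomonotone hI ⟨w, hw, z, hz, hwz⟩
      hlsc hJI hdense hloc hw hc₀ hb
    rcases eq_or_ne b 0 with rfl | hb₀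
    · exfalso
      obtain ⟨U, hU, hwU, hspm⟩ := hloc w (hmem w hw hb)
      obtain ⟨j, hj, hjU, hbtw⟩ := exists_mem_dense_between hI hdense hw hz hwz (hU.mem_nhds hwU)
      have hjε : dist j z < ε := by
        refine lt_of_le_of_lt ?_ hwε
        rw [Real.dist_eq, Real.dist_eq]
        exact sq_le_sq.1 (by nlinarith [sq_nonneg (j - w)])
      obtain ⟨c, hc, hac⟩ := hball hjε (hJI hj)
      have hjw : j ≠ w := by
        rintro rfl
        simp at hbtw
      have hsame : 0 < (w - j) * (w - z) := by nlinarith [sq_nonneg (w - j)]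
      have hcw : 0 < c * (w - j) :=
        mul_pos_trans (mul_comm a c ▸ hac) (mul_pos_trans haw' (mul_comm (w - j) _ ▸ hsame))
      simpa using hspm j ⟨hjU, hj⟩ w ⟨hwU, hmem w hw hb⟩ hjw c hc 0 hb hcw.le
    · have hc₀b : 0 < c₀ * b := hcb.lt_of_ne' (mul_ne_zero (right_ne_zero_of_mul hac₀.ne') hb₀)
      exact mul_pos_trans (mul_comm c₀ b ▸ hc₀b) (mul_pos_trans (mul_comm a c₀ ▸ hac₀) haw')

/-- A lower semicontinuous set-valued function on an interval `I ⊆ ℝ` which is locally strictly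
pseudomonotone on a dense subset `J ⊆ I` and satisfies `0 ∉ F x` for all `x ∈ I \ J` is
strictly pseudomonotone on `I`. -/
theorem strictly_pseudomonotone_of_dense
    (I : Set ℝ) (hI : I.OrdConnected) (F : ℝ → Set ℝ)
    (hne : ∀ x ∈ I, (F x).Nonempty)
    (hlsc : SVLscOn F I)
    (J : Set ℝ) (hJI : J ⊆ I) (hdense : I ⊆ closure J)
    (hloc : ∀ x ∈ J, ∃ U : Set ℝ, IsOpen U ∧ x ∈ U ∧ SVStrictlyPseudomonotoneOn F (U ∩ J))
    (hzero : ∀ x ∈ I \ J, (0 : ℝ) ∉ F x) :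
    SVStrictlyPseudomonotoneOn F I := by
  have hlocal : ∀ z ∈ I, ∀ a ∈ F z, ∃ ε > 0, ∀ w, |w - z| < ε → w ∈ I → w ≠ z →
      0 ≤ a * (w - z) → ∀ b ∈ F w, 0 < b * (w - z) := fun z hz a ha => by
    simpa [Real.dist_eq] using Metric.eventually_nhds_iff.1
      (eventually_mul_pos_of_locally_strictlyPseudomonotone hI hlsc hJI hdense hloc hzero hz ha)
  have hlt : ∀ x ∈ I, ∀ y ∈ I, x < y → ∀ a ∈ F x, ∀ b ∈ F y, 0 ≤ a → 0 < b := by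
    intro x hx y hy hxy a ha b hb ha₀
    by_contra! hb₀
    let B : Set ℝ := {w | x < w ∧ w ≤ y ∧ ∃ c ∈ F w, c ≤ 0}
    have hyB : y ∈ B := ⟨hxy, le_rfl, b, hb, hb₀⟩
    have hbdd : BddBelow B := ⟨x, fun w hw => hw.1.le⟩
    have hxm : x ≤ sInf B := le_csInf ⟨y, hyB⟩ fun w hw => hw.1.le
    have hmy : sInf B ≤ y := csInf_le hbdd hyB
    have hm : sInf B ∈ I := hI.out hx hy ⟨hxm, hmy⟩
    have hmB : sInf B ∉ B := fun hmB => by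
      obtain ⟨hxm', -, c, hc, hc₀⟩ := hmB
      obtain ⟨ε, hε, h⟩ := hlocal _ hm c hc
      obtain ⟨w, hw, hwm⟩ := exists_between (max_lt hxm' (sub_lt_self (sInf B) hε))
      obtain ⟨hxw, hεw⟩ := max_lt_iff.1 hw
      have hwI : w ∈ I := hI.out hx hm ⟨hxw.le, hwm.le⟩
      obtain ⟨d, hd⟩ := hne w hwI
      have hpos := h w (by rw [abs_lt]; constructor <;> linarith) hwI hwm.ne
        (mul_nonneg_of_nonpos_of_nonpos hc₀ (by linarith)) d hd
      have hd₀ : d < 0 := neg_of_mul_pos_left hpos (by linarith)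
      exact hwm.not_ge (csInf_le hbdd ⟨hxw, hwm.le.trans hmy, d, hd, hd₀.le⟩)
    obtain ⟨c, hc, hc₀⟩ : ∃ c ∈ F (sInf B), 0 ≤ c := by
      rcases hxm.eq_or_lt with heq | hlt
      · exact ⟨a, heq ▸ ha, ha₀⟩
      · obtain ⟨c, hc⟩ := hne _ hm
        exact ⟨c, hc, le_of_not_ge fun hc₀ => hmB ⟨hlt, hmy, c, hc, hc₀⟩⟩
    obtain ⟨ε, hε, h⟩ := hlocal _ hm c hc
    obtain ⟨w, hwB, hwε⟩ := exists_lt_of_csInf_lt ⟨y, hyB⟩ (lt_add_of_pos_right (sInf B) hε)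
    have hmw : sInf B < w := (csInf_le hbdd hwB).lt_of_ne fun heq => hmB (heq ▸ hwB)
    obtain ⟨hxw, hwy, d, hd, hd₀⟩ := hwB
    have hpos := h w (by rw [abs_lt]; constructor <;> linarith) (hI.out hx hy ⟨hxw.le, hwy⟩)
      hmw.ne' (mul_nonneg hc₀ (by linarith)) d hd
    exact absurd hpos (mul_nonpos_of_nonpos_of_nonneg hd₀ (by linarith)).not_gt
  intro x hx y hy hxy a ha b hb hab
  rcases lt_or_gt_of_ne hxy with h | h
  · exact mul_pos (hlt x hx y hy h a ha b hb (nonneg_of_mul_nonneg_left hab (sub_pos.2 h)))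
      (sub_pos.2 h)
  · refine mul_pos_of_neg_of_neg ?_ (sub_neg.2 h)
    by_contra! hb₀
    have ha₀ := hlt y hy x hx h b hb a ha hb₀
    exact absurd hab (mul_neg_of_pos_of_neg ha₀ (sub_neg.2 h)).not_ge
end
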